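/- For all β₁, β₂ ∈ Φ with β₁^ω ≠ 0: ((β₁^ω)^∨, β₂^ω) ∈ ℤ. -/

import Mathlib

open scoped RealInnerProductSpace

namespace Folding

variable {E : Type*} [NormedAddCommGroup E] [InnerProductSpace ℝ E]

/-- The coroot `α^∨ = 2α/(α,α)` of a nonzero vector `α`. -/
noncomputable def coroot (α : E) : E := (2 / ⟪α, α⟫) • α

/-- The reflection `s_α(x) = x - (α^∨, x) α`. -/
noncomputable def reflVec (α x : E) : E := x - ⟪coroot α, x⟫ • α

/-- `Φ` is a (finite, not necessarily reduced) root system in `E`. -/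
def IsRootSystem (Φ : Set E) : Prop :=
  Φ.Finite ∧ (0 : E) ∉ Φ ∧ Submodule.span ℝ Φ = ⊤ ∧
    (∀ α ∈ Φ, ∀ β ∈ Φ, reflVec α β ∈ Φ) ∧
    ∀ α ∈ Φ, ∀ β ∈ Φ, ∃ n : ℤ, ⟪coroot α, β⟫ = (n : ℝ)

/-- `Φ` is reduced: no root is half of another root. -/
def IsReducedRS (Φ : Set E) : Prop := ∀ α ∈ Φ, (2⁻¹ : ℝ) • α ∉ Φ

/-- `Φ` is irreducible: nonempty and not a disjoint union of two nonempty
mutually orthogonal subsets. -/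
def IsIrreducibleRS (Φ : Set E) : Prop :=
  Φ.Nonempty ∧
    ¬∃ Φ₁ Φ₂ : Set E, Φ₁.Nonempty ∧ Φ₂.Nonempty ∧ Φ₁ ∪ Φ₂ = Φ ∧ Disjoint Φ₁ Φ₂ ∧
      ∀ u ∈ Φ₁, ∀ v ∈ Φ₂, ⟪u, v⟫ = 0

/-- `Δ` is a basis (a set of simple roots) of the root system `Φ`:
it is a vector space basis of `E`, and every root is a linear combination of `Δ`
whose coefficients are all nonnegative integers or all nonpositive integers. -/
def IsBaseRS (Φ : Set E) (Δ : Finset E) : Prop :=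
  ↑Δ ⊆ Φ ∧ LinearIndependent ℝ (fun α : {x : E // x ∈ Δ} => (α : E)) ∧
    Submodule.span ℝ (Δ : Set E) = ⊤ ∧
    ∀ β ∈ Φ, ∃ c : E → ℤ, ((∀ α, 0 ≤ c α) ∨ (∀ α, c α ≤ 0)) ∧
      β = ∑ α ∈ Δ, (c α : ℝ) • α

/-- `ω` belongs to the Weyl group of `Φ`: it is a product of reflections in roots. -/
def InWeylGroup (Φ : Set E) (ω : E ≃ₗᵢ[ℝ] E) : Prop :=
  ∃ l : List E, (∀ α ∈ l, α ∈ Φ) ∧ ∀ x : E, ω x = l.foldr reflVec x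

/-- The average `x^ω = (1/o(ω)) Σ_{t=1}^{o(ω)} ω^t(x)`, where `o(ω)` is the order of `ω`. -/
noncomputable def avg (ω : E ≃ₗᵢ[ℝ] E) (x : E) : E :=
  (orderOf ω : ℝ)⁻¹ • ∑ t ∈ Finset.range (orderOf ω), (ω ^ (t + 1)) x

/-- The fixed-point set `E^ω`. -/
def fixedSet (ω : E ≃ₗᵢ[ℝ] E) : Set E := {x | ω x = x}

/-- The fixed-point subspace `E^ω`. -/
def fixedSubmodule (ω : E ≃ₗᵢ[ℝ] E) : Submodule ℝ E :=
  LinearMap.ker ((ω.toLinearEquiv : E →ₗ[ℝ] E) - LinearMap.id)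

/-- The folded root system `Φ_re^ω = {β^ω : β ∈ Φ, β^ω ≠ 0}`. -/
noncomputable def foldedRoots (Φ : Set E) (ω : E ≃ₗᵢ[ℝ] E) : Set E :=
  {v | v ≠ 0 ∧ ∃ β ∈ Φ, avg ω β = v}

/-- The `⟨ω⟩`-orbit `O(β) = {ω^t(β) : t ∈ ℤ}`. -/
def orbitOf (ω : E ≃ₗᵢ[ℝ] E) (β : E) : Set E := {γ | ∃ t : ℤ, (ω ^ t) β = γ}

/-- `N(β) = {γ ∈ O(β) : γ ≠ ±β, (β,γ) ≠ 0}`. -/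
def nbrOf (ω : E ≃ₗᵢ[ℝ] E) (β : E) : Set E :=
  {γ | γ ∈ orbitOf ω β ∧ γ ≠ β ∧ γ ≠ -β ∧ ⟪β, γ⟫ ≠ 0}


/-- `Δ^ω`: the averages of the simple roots whose `⟨ω⟩`-orbit avoids `α₀ = -htilde`. -/
noncomputable def simpleAvg (Δ : Finset E) (htilde : E) (ω : E ≃ₗᵢ[ℝ] E) : Set E :=
  {v | ∃ α ∈ (Δ : Set E), -htilde ∉ orbitOf ω α ∧ avg ω α = v}

/-- `π̄_S = (Σ_{α ∈ S} ϖ_α^∨)^ω` for a subset `S` of `Δ₀`. -/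
noncomputable def pibar (ω : E ≃ₗᵢ[ℝ] E) (ϖ : E → E) (S : Set E) : E :=
  avg ω (∑ᶠ γ ∈ S, ϖ γ)

end Folding


open Folding

namespace Folding

section Averages

variable {E : Type*} [NormedAddCommGroup E] [InnerProductSpace ℝ E]

theorem avg_map (ω : E ≃ₗᵢ[ℝ] E) (x : E) : avg ω (ω x) = avg ω x := by
  have key : ∀ n : ℕ, (ω ^ n) (ω x) = (ω ^ (n + 1)) x := fun n => by
    rw [pow_succ]; rfl
  unfold avg
  congr 1
  simp only [key]
  have h := (Finset.sum_range_succ' (fun t => (ω ^ (t + 1)) x) (orderOf ω)).symm.trans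
    (Finset.sum_range_succ (fun t => (ω ^ (t + 1)) x) (orderOf ω))
  rw [pow_succ ω (orderOf ω), pow_orderOf_eq_one] at h
  simpa using h

theorem avg_pow_map (ω : E ≃ₗᵢ[ℝ] E) (n : ℕ) (x : E) : avg ω ((ω ^ n) x) = avg ω x := by
  induction n with
  | zero => simp
  | succ k ih =>
    rw [pow_succ']
    exact (avg_map ω _).trans ih

theorem pow_map_of_fixed {ω : E ≃ₗᵢ[ℝ] E} {x : E} (hx : ω x = x) (n : ℕ) :
    (ω ^ n) x = x := by
  induction n with
  | zero => simp
  | succ k ih =>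
    rw [pow_succ]
    change (ω ^ k) (ω x) = x
    rw [hx, ih]

theorem avg_of_fixed {ω : E ≃ₗᵢ[ℝ] E} (ho : orderOf ω ≠ 0) {x : E} (hx : ω x = x) :
    avg ω x = x := by
  have h : (orderOf ω : ℝ) ≠ 0 := by exact_mod_cast ho
  simp only [avg, pow_map_of_fixed hx, Finset.sum_const, Finset.card_range]
  rw [← Nat.cast_smul_eq_nsmul ℝ, smul_smul, inv_mul_cancel₀ h, one_smul]

theorem avg_sum_smul (ω : E ≃ₗᵢ[ℝ] E) (c : ℝ) {ι : Type*} (s : Finset ι) (f : ι → E) :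
    avg ω (c • ∑ i ∈ s, f i) = c • ∑ i ∈ s, avg ω (f i) := by
  simp only [avg, map_smul, map_sum, ← Finset.smul_sum]
  rw [Finset.sum_comm, smul_comm]

theorem inner_avg_of_fixed {ω : E ≃ₗᵢ[ℝ] E} (ho : orderOf ω ≠ 0) {x : E} (hx : ω x = x)
    (y : E) : ⟪x, avg ω y⟫ = ⟪x, y⟫ := by
  have h : (orderOf ω : ℝ) ≠ 0 := by exact_mod_cast ho
  have key : ∀ n : ℕ, ⟪x, (ω ^ n) y⟫ = ⟪x, y⟫ := fun n => by
    conv_lhs => rw [← pow_map_of_fixed hx n]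
    exact (ω ^ n).inner_map_map x y
  simp only [avg, inner_smul_right, inner_sum, key, Finset.sum_const, Finset.card_range,
    nsmul_eq_mul]
  field_simp

/-- If `m` is a positive period of `x`, then the average of `x` is the mean of the first
`m` iterates, and this mean is fixed. -/
theorem avg_eq_mean_of_period {ω : E ≃ₗᵢ[ℝ] E} (ho : orderOf ω ≠ 0) {x : E} {m : ℕ}
    (hm : m ≠ 0) (hx : (ω ^ m) x = x) :
    avg ω x = (m : ℝ)⁻¹ • ∑ t ∈ Finset.range m, (ω ^ t) x ∧ ω (avg ω x) = avg ω x := by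
  have h : (m : ℝ) ≠ 0 := by exact_mod_cast hm
  set S : E := (m : ℝ)⁻¹ • ∑ t ∈ Finset.range m, (ω ^ t) x with hS
  have hfix : ω S = S := by
    have key : ∀ n : ℕ, ω ((ω ^ n) x) = (ω ^ (n + 1)) x := fun n => by
      rw [pow_succ']; rfl
    simp only [hS, map_smul, map_sum, key]
    congr 1
    have := (Finset.sum_range_succ' (fun t => (ω ^ t) x) m).symm.trans
      (Finset.sum_range_succ (fun t => (ω ^ t) x) m)
    rw [hx] at this
    simpa using this
  have havg : avg ω x = S := by
    rw [← avg_of_fixed ho hfix, hS, avg_sum_smul]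
    simp only [avg_pow_map, Finset.sum_const, Finset.card_range]
    rw [← Nat.cast_smul_eq_nsmul ℝ, smul_smul, inv_mul_cancel₀ h, one_smul]
  exact ⟨havg, by rw [havg, hfix]⟩

end Averages

section Roots

variable {E : Type*} [NormedAddCommGroup E] [InnerProductSpace ℝ E] {Φ : Set E}

theorem IsRootSystem.neg_mem (hΦ : IsRootSystem Φ) {β : E} (hβ : β ∈ Φ) : -β ∈ Φ := by
  have h0 : ⟪β, β⟫ ≠ 0 := inner_self_ne_zero.2 fun h => hΦ.2.1 (h ▸ hβ)
  have h := hΦ.2.2.2.1 β hβ β hβ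
  rw [reflVec, coroot, real_inner_smul_left, div_mul_cancel₀ _ h0, two_smul] at h
  simpa using h

theorem IsRootSystem.map_mem (hΦ : IsRootSystem Φ) {ω : E ≃ₗᵢ[ℝ] E} (hω : InWeylGroup Φ ω)
    {β : E} (hβ : β ∈ Φ) : ω β ∈ Φ := by
  obtain ⟨l, hl, h⟩ := hω
  rw [h]
  clear h
  induction l with
  | nil => exact hβ
  | cons a l ih =>
    exact hΦ.2.2.2.1 a (hl a (by simp)) _ (ih fun b hb => hl b (by simp [hb]))

theorem IsRootSystem.pow_map_mem (hΦ : IsRootSystem Φ) {ω : E ≃ₗᵢ[ℝ] E}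
    (hω : InWeylGroup Φ ω) {β : E} (hβ : β ∈ Φ) (n : ℕ) : (ω ^ n) β ∈ Φ := by
  induction n with
  | zero => simpa using hβ
  | succ k ih =>
    rw [pow_succ']
    exact hΦ.map_mem hω ih

/-- The difference of two distinct roots of equal length at an acute angle is a root. -/
theorem IsRootSystem.sub_mem (hΦ : IsRootSystem Φ) {β γ : E} (hβ : β ∈ Φ) (hγ : γ ∈ Φ)
    (hne : γ ≠ β) (hlen : ⟪γ, γ⟫ = ⟪β, β⟫) (hpos : 0 < ⟪γ, β⟫) : β - γ ∈ Φ := by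
  obtain ⟨n, hn⟩ := hΦ.2.2.2.2 γ hγ β hβ
  have hγ0 : 0 < ⟪γ, γ⟫ := real_inner_self_pos.2 fun h => hΦ.2.1 (h ▸ hγ)
  have hn' : 2 * ⟪γ, β⟫ = n * ⟪γ, γ⟫ := by
    rw [← hn, coroot, real_inner_smul_left]
    field_simp
  have hlt : 2 * ⟪γ, β⟫ < 2 * ⟪γ, γ⟫ := by
    have h : 0 < ⟪γ - β, γ - β⟫ := real_inner_self_pos.2 (sub_ne_zero.2 hne)
    rw [real_inner_sub_sub_self] at h
    linarith
  have h0 : (0 : ℝ) < n := by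
    by_contra! hc
    nlinarith
  have h2 : (n : ℝ) < 2 := by
    by_contra! hc
    nlinarith
  have h1 : n = 1 := by
    have : 0 < n := by exact_mod_cast h0
    have : n < 2 := by exact_mod_cast h2
    omega
  have h := hΦ.2.2.2.1 γ hγ β hβ
  rwa [reflVec, hn, h1, Int.cast_one, one_smul] at h

/-- The height of a vector: the linear functional taking the value `1` on each simple root. -/
theorem IsBaseRS.exists_height {Δ : Finset E} (hΔ : IsBaseRS Φ Δ) :
    ∃ ht : E →ₗ[ℝ] ℝ, ∀ α ∈ Δ, ht α = 1 := by
  let b := Module.Basis.mk hΔ.2.1 (by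
    have : Set.range (fun α : {x : E // x ∈ Δ} => (α : E)) = (Δ : Set E) := by
      ext; simp
    rw [this, hΔ.2.2.1])
  refine ⟨b.constr ℝ fun _ => (1 : ℝ), fun α hα => ?_⟩
  have := b.constr_basis ℝ (fun _ => (1 : ℝ)) ⟨α, hα⟩
  simpa [b] using this

theorem IsBaseRS.height_ne_zero {Δ : Finset E} (hΦ : IsRootSystem Φ) (hΔ : IsBaseRS Φ Δ)
    {ht : E →ₗ[ℝ] ℝ} (hht : ∀ α ∈ Δ, ht α = 1) {β : E} (hβ : β ∈ Φ) : ht β ≠ 0 := by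
  obtain ⟨c, hc, hsum⟩ := hΔ.2.2.2 β hβ
  intro h0
  have hs : ∑ α ∈ Δ, (c α : ℝ) = 0 := by
    rw [← h0, hsum, map_sum]
    exact Finset.sum_congr rfl fun α hα => by simp [hht α hα]
  have hz : ∀ α ∈ Δ, (c α : ℝ) = 0 := by
    rcases hc with hc | hc
    · exact (Finset.sum_eq_zero_iff_of_nonneg fun α _ => by exact_mod_cast hc α).1 hs
    · exact (Finset.sum_eq_zero_iff_of_nonpos fun α _ => by exact_mod_cast hc α).1 hs
  apply hΦ.2.1
  rw [hsum, Finset.sum_eq_zero fun α hα => by rw [hz α hα, zero_smul]] at hβ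
  exact hβ

/-- A linear map that preserves the heights of simple roots modulo `h` preserves the heights
of all roots modulo `h`. -/
theorem IsBaseRS.height_map_sub {Δ : Finset E} (hΔ : IsBaseRS Φ Δ)
    (ht : E →ₗ[ℝ] ℝ) {h : ℝ} {ω : E ≃ₗᵢ[ℝ] E}
    (hω : ∀ α ∈ Δ, ∃ j : ℤ, ht (ω α) - ht α = j * h) {β : E} (hβ : β ∈ Φ) :
    ∃ j : ℤ, ht (ω β) - ht β = j * h := by
  obtain ⟨c, -, hsum⟩ := hΔ.2.2.2 β hβ
  choose! j hj using hω
  refine ⟨∑ α ∈ Δ, c α * j α, ?_⟩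
  rw [hsum]
  simp only [map_sum, map_smul, smul_eq_mul, ← Finset.sum_sub_distrib, ← mul_sub]
  push_cast
  rw [Finset.sum_mul]
  exact Finset.sum_congr rfl fun α hα => by rw [hj α hα, mul_assoc]

/-- Distinct roots in the same orbit of an automorphism of the extended Dynkin diagram never
form an acute angle: their difference would be a root of height divisible by the Coxeter
number. -/
theorem inner_pow_map_nonpos {Δ : Finset E} {htilde : E} {ω : E ≃ₗᵢ[ℝ] E}
    (hΦ : IsRootSystem Φ) (hΔ : IsBaseRS Φ Δ) {ht : E →ₗ[ℝ] ℝ} (hht : ∀ α ∈ Δ, ht α = 1)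
    (hhighest : ∀ β ∈ Φ, ht β ≤ ht htilde) (hωW : InWeylGroup Φ ω)
    (hωΔ₀ : ∀ α ∈ Δ, ω α ∈ Δ ∨ ω α = -htilde) {β : E} (hβ : β ∈ Φ) (n : ℕ)
    (hne : (ω ^ n) β ≠ β) : ⟪(ω ^ n) β, β⟫ ≤ 0 := by
  have hstep : ∀ γ ∈ Φ, ∃ j : ℤ, ht (ω γ) - ht γ = j * (ht htilde + 1) := fun γ hγ =>
    hΔ.height_map_sub ht (fun α hα => by
      rcases hωΔ₀ α hα with h | h
      · exact ⟨0, by simp [hht _ h, hht _ hα]⟩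
      · exact ⟨-1, by rw [h, map_neg, hht _ hα]; push_cast; ring⟩) hγ
  have hiter : ∃ j : ℤ, ht ((ω ^ n) β) - ht β = j * (ht htilde + 1) := by
    clear hne
    induction n with
    | zero => exact ⟨0, by simp⟩
    | succ k ih =>
      obtain ⟨j, hj⟩ := ih
      obtain ⟨i, hi⟩ := hstep _ (hΦ.pow_map_mem hωW hβ k)
      refine ⟨i + j, ?_⟩
      rw [pow_succ']
      change ht (ω ((ω ^ k) β)) - ht β = _
      push_cast
      linarith
  by_contra! hpos
  have hmem := hΦ.sub_mem hβ (hΦ.pow_map_mem hωW hβ n) hne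
    ((ω ^ n).inner_map_map β β) hpos
  obtain ⟨j, hj⟩ := hiter
  have h0 := hΔ.height_ne_zero hΦ hht hmem
  have h1 := hhighest _ hmem
  have h2 := hhighest _ (hΦ.neg_mem hmem)
  rw [map_neg] at h2
  rw [map_sub] at h0 h1 h2
  have hj0 : j ≠ 0 := by
    rintro rfl
    apply h0
    simp at hj
    linarith
  rcases lt_or_gt_of_ne hj0 with hlt | hgt
  · have : (j : ℝ) ≤ -1 := by exact_mod_cast (by omega : j ≤ -1)
    nlinarith
  · have : (1 : ℝ) ≤ j := by exact_mod_cast (by omega : 1 ≤ j)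
    nlinarith

theorem inner_pow_map_eq (hΦ : IsRootSystem Φ) {ω : E ≃ₗᵢ[ℝ] E} (hω : InWeylGroup Φ ω)
    {β γ : E} (hβ : β ∈ Φ) (hγ : γ ∈ Φ) (n : ℕ) :
    ∃ k : ℤ, ⟪(ω ^ n) β, γ⟫ = ⟪β, β⟫ / 2 * k := by
  obtain ⟨k, hk⟩ := hΦ.2.2.2.2 _ (hΦ.pow_map_mem hω hβ n) γ hγ
  refine ⟨k, ?_⟩
  have h0 : ⟪β, β⟫ ≠ 0 := inner_self_ne_zero.2 fun h => hΦ.2.1 (h ▸ hβ)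
  have hlen : ⟪(ω ^ n) β, (ω ^ n) β⟫ = ⟪β, β⟫ := (ω ^ n).inner_map_map β β
  rw [← hk, coroot, real_inner_smul_left, hlen]
  field_simp

end Roots

end Folding

theorem folded_integrality
    {E : Type*} [NormedAddCommGroup E] [InnerProductSpace ℝ E] [FiniteDimensional ℝ E]
    (Φ : Set E) (Δ : Finset E) (coeff : E → E → ℝ) (htilde : E) (ω : E ≃ₗᵢ[ℝ] E)
    (hΦrs : IsRootSystem Φ) (hΦred : IsReducedRS Φ) (hΦirr : IsIrreducibleRS Φ)
    (hΔ : IsBaseRS Φ Δ)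
    (hcoeff : ∀ β ∈ Φ, β = ∑ α ∈ Δ, coeff β α • α)
    (hht : htilde ∈ Φ)
    (hhighest : ∀ β ∈ Φ, β ≠ htilde → ∑ α ∈ Δ, coeff β α < ∑ α ∈ Δ, coeff htilde α)
    (hωW : InWeylGroup Φ ω)
    (hωΔ₀ : ⇑ω '' (↑Δ ∪ {-htilde}) = ↑Δ ∪ {-htilde}) :
    ∀ β₁ ∈ Φ, ∀ β₂ ∈ Φ, avg ω β₁ ≠ 0 →
      ∃ n : ℤ, ⟪coroot (avg ω β₁), avg ω β₂⟫ = (n : ℝ) := by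
  intro β₁ hβ₁ β₂ hβ₂ hne
  have ho : orderOf ω ≠ 0 := fun h => hne (by simp [avg, h])
  obtain ⟨ht, hsimple⟩ := hΔ.exists_height
  have hcoeffsum : ∀ β ∈ Φ, ht β = ∑ α ∈ Δ, coeff β α := fun β hβ => by
    conv_lhs => rw [hcoeff β hβ, map_sum]
    exact Finset.sum_congr rfl fun α hα => by simp [hsimple α hα]
  have hmax : ∀ β ∈ Φ, ht β ≤ ht htilde := fun β hβ => by
    rcases eq_or_ne β htilde with rfl | h
    · exact le_rfl
    · rw [hcoeffsum β hβ, hcoeffsum _ hht]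
      exact (hhighest β hβ h).le
  have hperm : ∀ α ∈ Δ, ω α ∈ Δ ∨ ω α = -htilde := fun α hα => by
    have h : ω α ∈ ⇑ω '' (↑Δ ∪ {-htilde}) := ⟨α, Or.inl hα, rfl⟩
    rw [hωΔ₀] at h
    simpa [or_comm] using h
  have hex : ∃ m : ℕ, 0 < m ∧ (ω ^ m) β₁ = β₁ :=
    ⟨orderOf ω, Nat.pos_of_ne_zero ho, by rw [pow_orderOf_eq_one]; rfl⟩
  classical
  set m := Nat.find hex
  obtain ⟨hmpos, hper⟩ := Nat.find_spec hex
  have hmin : ∀ t, 0 < t → t < m → (ω ^ t) β₁ ≠ β₁ := fun t ht0 htm h =>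
    Nat.find_min hex htm ⟨ht0, h⟩
  obtain ⟨hmean, hfix⟩ := avg_eq_mean_of_period ho hmpos.ne' hper
  have hm0 : (0 : ℝ) < m := by exact_mod_cast hmpos
  have hβ0 : 0 < ⟪β₁, β₁⟫ := real_inner_self_pos.2 fun h => hΦrs.2.1 (h ▸ hβ₁)
  choose k hk using fun t => inner_pow_map_eq hΦrs hωW hβ₁ hβ₂ t
  choose l hl using fun t => inner_pow_map_eq hΦrs hωW hβ₁ hβ₁ t
  have hN : ⟪avg ω β₁, avg ω β₂⟫ =
      (m : ℝ)⁻¹ * (⟪β₁, β₁⟫ / 2 * ((∑ t ∈ Finset.range m, k t : ℤ) : ℝ)) := by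
    rw [inner_avg_of_fixed ho hfix, hmean, real_inner_smul_left, sum_inner]
    push_cast
    simp only [hk, Finset.mul_sum]
    rfl
  have hD : ⟪avg ω β₁, avg ω β₁⟫ =
      (m : ℝ)⁻¹ * (⟪β₁, β₁⟫ / 2 * ((∑ t ∈ Finset.range m, l t : ℤ) : ℝ)) := by
    rw [inner_avg_of_fixed ho hfix, hmean, real_inner_smul_left, sum_inner]
    push_cast
    simp only [hl, Finset.mul_sum]
    rfl
  have hDpos : 0 < ⟪avg ω β₁, avg ω β₁⟫ := real_inner_self_pos.2 hne
  have hl0 : l 0 = 2 := by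
    have h := hl 0
    rw [pow_zero] at h
    change ⟪β₁, β₁⟫ = _ at h
    have : (l 0 : ℝ) = 2 := by
      field_simp at h
      linarith
    exact_mod_cast this
  have hlneg : ∀ t, 0 < t → t < m → l t ≤ 0 := fun t ht0 htm => by
    have h := inner_pow_map_nonpos hΦrs hΔ hsimple hmax hωW hperm hβ₁ t (hmin t ht0 htm)
    rw [hl] at h
    have : (l t : ℝ) ≤ 0 := by
      by_contra! hc
      have : 0 < ⟪β₁, β₁⟫ / 2 * (l t : ℝ) := by positivity
      linarith
    exact_mod_cast this
  set D : ℤ := ∑ t ∈ Finset.range m, l t with hDdef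
  set N : ℤ := ∑ t ∈ Finset.range m, k t
  have hDle : D ≤ 2 := by
    rw [hDdef, ← Finset.add_sum_erase _ _ (Finset.mem_range.2 hmpos), hl0]
    have : ∑ t ∈ (Finset.range m).erase 0, l t ≤ 0 := Finset.sum_nonpos fun t ht => by
      rw [Finset.mem_erase, Finset.mem_range] at ht
      exact hlneg t (Nat.pos_of_ne_zero ht.1) ht.2
    linarith
  have hD0 : (0 : ℝ) < D := by
    rw [hD] at hDpos
    by_contra! hc
    have h1 : ⟪β₁, β₁⟫ / 2 * (D : ℝ) ≤ 0 :=
      mul_nonpos_of_nonneg_of_nonpos (by positivity) hc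
    have h2 := mul_nonpos_of_nonneg_of_nonpos (inv_nonneg.2 hm0.le) h1
    linarith
  have hval : ⟪coroot (avg ω β₁), avg ω β₂⟫ = 2 * (N : ℝ) / D := by
    rw [coroot, real_inner_smul_left, hN, hD]
    field_simp
  have hDpos' : 0 < D := by exact_mod_cast hD0
  rw [hval]
  obtain h | h : D = 1 ∨ D = 2 := by omega
  · exact ⟨2 * N, by rw [h]; push_cast; ring⟩
  · exact ⟨N, by rw [h]; push_cast; ring⟩
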